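/- Let (X̄,σ̄) be an infinite minimal two-sided shift whose complexity function satisfies p(n) = n + 1 for all n ≥ 1 (an infinite minimal Sturmian shift). Then every automorphism of (X̄,σ̄) is a power of the shift, i.e., Aut(X̄,σ̄)/{σ̄ⁿ} is trivial. -/

import Mathlib

/-- The two-sided shift map on `A^ℤ`. -/
def shiftZ {A : Type*} (x : ℤ → A) : ℤ → A := fun n => x (n + 1)

/-- The `n`-th power of the two-sided shift, `n ∈ ℤ`. -/
def shiftZIter {A : Type*} (n : ℤ) (x : ℤ → A) : ℤ → A := fun m => x (m + n)

/-- The (two-sided) shift orbit of a point. -/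
def orbitZ {A : Type*} (x : ℤ → A) : Set (ℤ → A) :=
  Set.range fun n : ℤ => shiftZIter n x

/-- Two points of `A^ℤ` are right asymptotic if they eventually agree to the right. -/
def RightAsymptotic {A : Type*} (x y : ℤ → A) : Prop :=
  ∃ N : ℤ, ∀ n : ℤ, N ≤ n → x n = y n

/-- Minimality of a two-sided shift: every orbit is dense in `X`. -/
def MinimalZ {A : Type*} [TopologicalSpace A] (X : Set (ℤ → A)) : Prop :=
  ∀ x ∈ X, X ⊆ closure (orbitZ x)

/-- An automorphism of the two-sided shift `(X, σ̄)`: a self-homeomorphism of `X`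
commuting with the shift. -/
def IsAutZ {A : Type*} [TopologicalSpace A] (X : Set (ℤ → A)) (Φ : X ≃ₜ X) : Prop :=
  ∀ x y : X, (y : ℤ → A) = shiftZ (x : ℤ → A) → (Φ y : ℤ → A) = shiftZ (Φ x : ℤ → A)

/-- The complexity function of a two-sided shift. -/
noncomputable def complexityZ {A : Type*} [Fintype A] (X : Set (ℤ → A)) (n : ℕ) : ℕ :=
  Nat.card {w : Fin n → A | ∃ x ∈ X, ∃ i : ℤ, ∀ j : Fin n, w j = x (i + (j : ℕ))}

open Filter Topology

theorem Finite.eq_of_surjective_of_card_eq_add_one {α β : Type*} [Finite α] {f : α → β}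
    (hf : Function.Surjective f) (hcard : Nat.card α = Nat.card β + 1) {a a' b b' : α}
    (ha : a ≠ a') (haf : f a = f a') (hb : b ≠ b') (hbf : f b = f b') : f a = f b := by
  by_contra hne
  have hab : a ≠ b := fun h => hne (congrArg f h)
  have hsurj : Function.Surjective fun c : (({a, b} : Set α)ᶜ : Set α) => f c := by
    intro z
    obtain ⟨c, rfl⟩ := hf z
    by_cases hca : c = a
    · exact ⟨⟨a', by grind⟩, by grind⟩
    by_cases hcb : c = b
    · exact ⟨⟨b', by grind⟩, by grind⟩
    exact ⟨⟨c, by grind⟩, rfl⟩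
  have hle := Nat.card_le_card_of_surjective _ hsurj
  have hadd := Set.ncard_add_ncard_compl ({a, b} : Set α)
  rw [Set.ncard_pair hab] at hadd
  rw [Nat.card_coe_set_eq] at hle
  omega

/-- The words of length `n` occurring in points of `X`. -/
def wordsZ {A : Type*} (X : Set (ℤ → A)) (n : ℕ) : Set (Fin n → A) :=
  {w | ∃ x ∈ X, ∃ i : ℤ, ∀ j : Fin n, w j = x (i + (j : ℕ))}

/-- The block of length `n` of `x` starting at `i`, as a word of `X`. -/
def blockZ {A : Type*} {X : Set (ℤ → A)} (n : ℕ) (x : X) (i : ℤ) : wordsZ X n :=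
  ⟨fun j => x.1 (i + (j : ℕ)), x.1, x.2, i, fun _ => rfl⟩

/-- Deleting the last letter of a word of `X`. -/
def wordsZInit {A : Type*} {X : Set (ℤ → A)} (n : ℕ) (w : wordsZ X (n + 1)) : wordsZ X n :=
  ⟨fun j => w.1 j.castSucc, by
    obtain ⟨x, hx, i, h⟩ := w.2
    exact ⟨x, hx, i, fun j => h j.castSucc⟩⟩

section Words

variable {A : Type*} {X : Set (ℤ → A)}

theorem exists_blockZ_eq {n : ℕ} (w : wordsZ X n) : ∃ (x : X) (i : ℤ), blockZ n x i = w := by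
  obtain ⟨x, hx, i, h⟩ := w.2
  exact ⟨⟨x, hx⟩, i, Subtype.ext (funext fun j => (h j).symm)⟩

theorem blockZ_eq_iff {n : ℕ} {x y : X} {i k : ℤ} :
    blockZ n x i = blockZ n y k ↔ ∀ j < n, x.1 (i + (j : ℕ)) = y.1 (k + (j : ℕ)) := by
  refine ⟨fun h j hj => congrFun (congrArg Subtype.val h) ⟨j, hj⟩, fun h => ?_⟩
  exact Subtype.ext (funext fun j => h j j.2)

theorem wordsZInit_surjective (n : ℕ) :
    Function.Surjective (wordsZInit (X := X) n) := by
  intro w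
  obtain ⟨x, i, rfl⟩ := exists_blockZ_eq w
  exact ⟨blockZ (n + 1) x i, rfl⟩

/-- If `p(n + 1) = p(n) + 1` then there is only one right special word of length `n`. -/
theorem blockZ_eq_of_right_special [Finite A] {n : ℕ}
    (hcard : Nat.card (wordsZ X (n + 1)) = Nat.card (wordsZ X n) + 1) {x y x' y' : X} {i i' : ℤ}
    (h : blockZ n x i = blockZ n y i) (hne : x.1 (i + n) ≠ y.1 (i + n))
    (h' : blockZ n x' i' = blockZ n y' i') (hne' : x'.1 (i' + n) ≠ y'.1 (i' + n)) :
    blockZ n x i = blockZ n x' i' := by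
  refine Finite.eq_of_surjective_of_card_eq_add_one (wordsZInit_surjective n) hcard
    (a := blockZ (n + 1) x i) (a' := blockZ (n + 1) y i)
    (b := blockZ (n + 1) x' i') (b' := blockZ (n + 1) y' i') ?_ h ?_ h'
  · exact fun e => hne (blockZ_eq_iff.1 e n n.lt_succ_self)
  · exact fun e => hne' (blockZ_eq_iff.1 e n n.lt_succ_self)

/-- If `p(n + 1) > p(n)` then there is a right special word of length `n`. -/
theorem exists_right_special [Finite A] {n : ℕ}
    (hcard : Nat.card (wordsZ X n) < Nat.card (wordsZ X (n + 1))) :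
    ∃ (x y : X) (i k : ℤ), blockZ n x i = blockZ n y k ∧ x.1 (i + n) ≠ y.1 (k + n) := by
  have hinj : ¬ Function.Injective (wordsZInit (X := X) n) := fun h =>
    hcard.not_ge (Nat.card_le_card_of_injective _ h)
  simp only [Function.Injective, not_forall] at hinj
  obtain ⟨w, w', h, hne⟩ := hinj
  obtain ⟨x, i, rfl⟩ := exists_blockZ_eq w
  obtain ⟨y, k, rfl⟩ := exists_blockZ_eq w'
  refine ⟨x, y, i, k, h, fun e => hne (blockZ_eq_iff.2 fun j hj => ?_)⟩
  rcases Nat.lt_succ_iff_lt_or_eq.1 hj with hj | rfl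
  · exact blockZ_eq_iff.1 h j hj
  · exact e

theorem shiftZIter_mem (hinv : shiftZ '' X = X) (n : ℤ) {x : ℤ → A} (hx : x ∈ X) :
    shiftZIter n x ∈ X := by
  induction n using Int.induction_on with
  | zero =>
    have : shiftZIter 0 x = x := funext fun m => congrArg x (add_zero m)
    rwa [this]
  | succ n ih =>
    rw [← hinv]
    refine ⟨_, ih, funext fun m => ?_⟩
    simp only [shiftZ, shiftZIter]
    congr 1; ring
  | pred n ih =>
    rw [← hinv] at ih
    obtain ⟨y, hy, h⟩ := ih
    convert hy using 1
    funext m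
    have := congrFun h (m - 1)
    simp only [shiftZ, shiftZIter, sub_add_cancel] at this ⊢
    rw [this]
    congr 1; ring

/-- The powers of the shift acting on an invariant set. -/
def shiftOnZ (hinv : shiftZ '' X = X) (n : ℤ) (x : X) : X :=
  ⟨shiftZIter n x.1, shiftZIter_mem hinv n x.2⟩

@[simp] theorem shiftOnZ_apply (hinv : shiftZ '' X = X) (n : ℤ) (x : X) (m : ℤ) :
    (shiftOnZ hinv n x).1 m = x.1 (m + n) := rfl

theorem shiftOnZ_zero (hinv : shiftZ '' X = X) (x : X) : shiftOnZ hinv 0 x = x :=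
  Subtype.ext (funext fun m => by simp)

theorem shiftOnZ_add_one (hinv : shiftZ '' X = X) (n : ℤ) (x : X) :
    shiftOnZ hinv (n + 1) x = shiftOnZ hinv 1 (shiftOnZ hinv n x) :=
  Subtype.ext (funext fun m => congrArg x.1 (by ring))

theorem shiftOnZ_neg_one (hinv : shiftZ '' X = X) (x : X) :
    shiftOnZ hinv 1 (shiftOnZ hinv (-1) x) = x :=
  Subtype.ext (funext fun m => congrArg x.1 (by ring))

theorem shiftOnZ_one_injective (hinv : shiftZ '' X = X) :
    Function.Injective (shiftOnZ hinv 1) := fun x y h =>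
  Subtype.ext (funext fun m => by
    simpa using congrFun (congrArg Subtype.val h) (m - 1))

variable [TopologicalSpace A]

theorem IsAutZ.map_shiftOnZ {Φ : X ≃ₜ X} (hΦ : IsAutZ X Φ) (hinv : shiftZ '' X = X) (n : ℤ)
    (x : X) : Φ (shiftOnZ hinv n x) = shiftOnZ hinv n (Φ x) := by
  have hone (x : X) : Φ (shiftOnZ hinv 1 x) = shiftOnZ hinv 1 (Φ x) :=
    Subtype.ext (hΦ x (shiftOnZ hinv 1 x) rfl)
  induction n using Int.induction_on with
  | zero => rw [shiftOnZ_zero, shiftOnZ_zero]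
  | succ n ih => rw [shiftOnZ_add_one, hone, ih, ← shiftOnZ_add_one]
  | pred n ih =>
    apply shiftOnZ_one_injective hinv
    rw [← hone, ← shiftOnZ_add_one, ← shiftOnZ_add_one, sub_add_cancel, ih]

theorem IsAutZ.apply_add {Φ : X ≃ₜ X} (hΦ : IsAutZ X Φ) (hinv : shiftZ '' X = X) (x : X)
    (m n : ℤ) : (Φ x).1 (m + n) = (Φ (shiftOnZ hinv n x)).1 m := by
  rw [hΦ.map_shiftOnZ hinv, shiftOnZ_apply]

theorem continuous_coordZ (m : ℤ) : Continuous fun x : X => x.1 m :=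
  (continuous_apply m).comp continuous_subtype_val

variable [DiscreteTopology A]

/-- If `p(n + 1) > p(n)` for infinitely many `n`, there is a pair of points agreeing exactly up to
time `0`. -/
theorem exists_left_asymptotic_pair [Finite A] (hclosed : IsClosed X) (hinv : shiftZ '' X = X)
    (hcard : ∀ n : ℕ, 1 ≤ n → Nat.card (wordsZ X n) < Nat.card (wordsZ X (n + 1))) :
    ∃ u v : X, (∀ m < 0, u.1 m = v.1 m) ∧ u.1 0 ≠ v.1 0 := by
  have : CompactSpace X := isCompact_iff_compactSpace.1 hclosed.isCompact
  let K : ℕ → Set (X × X) := fun n =>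
    {p | (∀ m ∈ Set.Ico (-(n : ℤ)) 0, p.1.1 m = p.2.1 m) ∧ p.1.1 0 ≠ p.2.1 0}
  have hc (m : ℤ) : Continuous fun p : X × X => (p.1.1 m, p.2.1 m) :=
    ((continuous_coordZ m).comp continuous_fst).prodMk ((continuous_coordZ m).comp continuous_snd)
  have hK (n : ℕ) : IsClosed (K n) := by
    have : K n = (⋂ m ∈ Set.Ico (-(n : ℤ)) 0,
        (fun p : X × X => (p.1.1 m, p.2.1 m)) ⁻¹' {q | q.1 = q.2}) ∩
        (fun p : X × X => (p.1.1 0, p.2.1 0)) ⁻¹' {q | q.1 ≠ q.2} := by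
      ext p; simp [K]
    rw [this]
    exact (isClosed_biInter fun m _ => (isClosed_discrete _).preimage (hc m)).inter
      ((isClosed_discrete _).preimage (hc 0))
  have hne (n : ℕ) : (K n).Nonempty := by
    obtain ⟨x, y, i, k, h, hxy⟩ := exists_right_special (hcard (n + 1) (by omega))
    refine ⟨(shiftOnZ hinv (i + (n + 1 : ℕ)) x, shiftOnZ hinv (k + (n + 1 : ℕ)) y),
      fun m hm => ?_, by simpa using hxy⟩
    have hm1 := hm.1
    have hm2 := hm.2
    have := blockZ_eq_iff.1 h (m + (n + 1)).toNat (by omega)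
    simp only [shiftOnZ_apply]
    convert this using 2 <;> omega
  obtain ⟨⟨u, v⟩, huv⟩ := IsCompact.nonempty_iInter_of_sequence_nonempty_isCompact_isClosed K
    (fun n p hp => ⟨fun m hm => hp.1 m ⟨by have := hm.1; push_cast; omega, hm.2⟩, hp.2⟩)
    hne (hK 0).isCompact hK
  rw [Set.mem_iInter] at huv
  exact ⟨u, v, fun m hm => (huv m.natAbs).1 m ⟨by omega, hm⟩, (huv 0).2⟩

/-- An automorphism preserves left asymptotic pairs. -/
theorem IsAutZ.eventually_eq_atBot [Finite A] (hclosed : IsClosed X) (hinv : shiftZ '' X = X)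
    {Φ : X ≃ₜ X} (hΦ : IsAutZ X Φ) {u v : X} (huv : ∀ᶠ m in atBot, u.1 m = v.1 m) :
    ∀ᶠ m in atBot, (Φ u).1 m = (Φ v).1 m := by
  have : CompactSpace X := isCompact_iff_compactSpace.1 hclosed.isCompact
  by_contra h
  have : NeBot (atBot ⊓ 𝓟 {m : ℤ | (Φ u).1 m ≠ (Φ v).1 m}) :=
    frequently_mem_iff_neBot.1 (not_eventually.1 h)
  let l : Ultrafilter ℤ := Ultrafilter.of (atBot ⊓ 𝓟 {m : ℤ | (Φ u).1 m ≠ (Φ v).1 m})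
  have hl : (l : Filter ℤ) ≤ atBot ⊓ 𝓟 {m : ℤ | (Φ u).1 m ≠ (Φ v).1 m} := Ultrafilter.of_le _
  obtain ⟨w, hw⟩ : ∃ w : X, Tendsto (fun j => shiftOnZ hinv j u) l (𝓝 w) :=
    ⟨_, (l.map fun j => shiftOnZ hinv j u).le_nhds_lim⟩
  have hw' : Tendsto (fun j => shiftOnZ hinv j v) l (𝓝 w) := by
    refine tendsto_subtype_rng.2 (tendsto_pi_nhds.2 fun m => ?_)
    refine (((continuous_coordZ m).tendsto w).comp hw).congr' ?_
    exact hl.trans inf_le_left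
      ((tendsto_atBot_add_const_left atBot m tendsto_id).eventually huv :)
  have hcont : Continuous fun x => (Φ x).1 0 := (continuous_coordZ 0).comp Φ.continuous
  have key := (tendsto_pure.1 (nhds_discrete A ▸ (hcont.tendsto w).comp hw)).and
    (tendsto_pure.1 (nhds_discrete A ▸ (hcont.tendsto w).comp hw'))
  obtain ⟨j, ⟨hj, hj'⟩, hne⟩ := (key.and (hl.trans inf_le_right (mem_principal_self _))).exists
  simp only [Function.comp_apply, ← hΦ.apply_add hinv, zero_add] at hj hj'
  exact hne (hj.trans hj'.symm)

/-- If `Φ u` agrees on the left with `σᵏ u`, then `Φ = σᵏ`. -/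
theorem IsAutZ.eq_shiftZIter [Finite A] (hclosed : IsClosed X) (hinv : shiftZ '' X = X)
    (hmin : MinimalZ X) {Φ : X ≃ₜ X} (hΦ : IsAutZ X Φ) {u : X} {k : ℤ}
    (hu : ∀ᶠ m in atBot, (Φ u).1 m = u.1 (m + k)) (x : X) :
    (Φ x : ℤ → A) = shiftZIter k (x : ℤ → A) := by
  have : CompactSpace X := isCompact_iff_compactSpace.1 hclosed.isCompact
  let l : Ultrafilter ℤ := Ultrafilter.of atBot
  obtain ⟨w, hw⟩ : ∃ w : X, Tendsto (fun j => shiftOnZ hinv j u) l (𝓝 w) :=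
    ⟨_, (l.map fun j => shiftOnZ hinv j u).le_nhds_lim⟩
  have hΦw (m : ℤ) : (Φ w).1 m = w.1 (m + k) := by
    refine tendsto_nhds_unique_of_eventuallyEq
      ((((continuous_coordZ m).comp Φ.continuous).tendsto w).comp hw)
      (((continuous_coordZ (m + k)).tendsto w).comp hw) ?_
    have := (tendsto_atBot_add_const_left atBot m tendsto_id).eventually hu
    filter_upwards [Ultrafilter.of_le atBot this] with j hj
    simp only [id] at hj
    simp only [Function.comp_apply, ← hΦ.apply_add hinv, hj, shiftOnZ_apply]
    exact congrArg _ (by ring)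
  have hdense : Dense (Set.range fun n => shiftOnZ hinv n w) := by
    intro x
    rw [closure_subtype, ← Set.range_comp]
    exact hmin w w.2 x.2
  funext m
  refine congrFun (Continuous.ext_on hdense ((continuous_coordZ m).comp Φ.continuous)
    (continuous_coordZ (m + k)) ?_) x
  rintro _ ⟨n, rfl⟩
  simp only [Function.comp_apply, ← hΦ.apply_add hinv, hΦw, shiftOnZ_apply]
  exact congrArg _ (by ring)

end Words

/-- Every automorphism of an infinite minimal two-sided Sturmian shift
(complexity `p(n) = n + 1` for all `n ≥ 1`) is a power of the shift: the quotient
`Aut(X̄,σ̄)/{σ̄ⁿ}` is trivial. -/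
theorem sturmian_two_sided_aut_is_shift_power
    {A : Type*} [Fintype A] [TopologicalSpace A] [DiscreteTopology A]
    (X : Set (ℤ → A)) (hne : X.Nonempty) (hclosed : IsClosed X)
    (hinv : shiftZ '' X = X)
    (hmin : MinimalZ X) (hinf : X.Infinite)
    (hstur : ∀ n : ℕ, 1 ≤ n → complexityZ X n = n + 1) :
    ∀ Φ : X ≃ₜ X, IsAutZ X Φ →
      ∃ n : ℤ, ∀ x : X, (Φ x : ℤ → A) = shiftZIter n (x : ℤ → A) := by
  intro Φ hΦ
  have hcard (n : ℕ) (hn : 1 ≤ n) : Nat.card (wordsZ X n) = n + 1 := hstur n hn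
  obtain ⟨u, v, huv, h0⟩ := exists_left_asymptotic_pair hclosed hinv fun n hn => by
    rw [hcard n hn, hcard (n + 1) (by omega)]; omega
  have hev : ∀ᶠ m in atBot, (Φ u).1 m = (Φ v).1 m :=
    hΦ.eventually_eq_atBot hclosed hinv ((eventually_lt_atBot 0).mono huv)
  obtain ⟨b, hb⟩ := eventually_atBot.1 hev
  have hex : ∃ m, (Φ u).1 m ≠ (Φ v).1 m := by
    by_contra! h
    exact h0 (by rw [Φ.injective (Subtype.ext (funext h))])
  obtain ⟨N, hN, hlt⟩ := Int.exists_least_of_bdd (P := fun m => (Φ u).1 m ≠ (Φ v).1 m)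
    ⟨b, fun m hm => not_lt.1 fun h => hm (hb m h.le)⟩ hex
  replace hlt (m : ℤ) (hm : m < N) : (Φ u).1 m = (Φ v).1 m :=
    of_not_not fun h => (hlt m h).not_gt hm
  refine ⟨-N, hΦ.eq_shiftZIter hclosed hinv hmin (u := u) ?_⟩
  filter_upwards [eventually_lt_atBot N] with m hm
  obtain ⟨n, rfl⟩ : ∃ n : ℕ, m = N - n := ⟨(N - m).toNat, by omega⟩
  have hn : 1 ≤ n := by omega
  have := blockZ_eq_of_right_special (n := n) (x := Φ u) (y := Φ v) (i := N - n)
    (x' := u) (y' := v) (i' := -n) (by rw [hcard n hn, hcard (n + 1) (by omega)])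
    (blockZ_eq_iff.2 fun j hj => hlt _ (by omega)) (by simpa using hN)
    (blockZ_eq_iff.2 fun j hj => huv _ (by omega)) (by simpa using h0)
  simpa [sub_eq_add_neg, add_comm] using blockZ_eq_iff.1 this 0 (by omega)
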